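/- For every positive integer n, the quotient ring K[X]/P_2 by the ideal of principal 2-minors is a normal domain, i.e., an integral domain that is integrally closed in its field of fractions. -/

import Mathlib

open Matrix

/-- The generic `n × n` matrix whose entries are the variables `x i j` of the
polynomial ring `K[X]`. -/
noncomputable def genMat (K : Type*) [Field K] (n : ℕ) :
    Matrix (Fin n) (Fin n) (MvPolynomial (Fin n × Fin n) K) :=
  fun i j => MvPolynomial.X (i, j)

/-- `P_t`: the ideal generated by the principal `t`-minors of the generic matrix,
i.e. the determinants of the submatrices whose rows and columns are both indexed by
a subset `s` of cardinality `t`. -/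
noncomputable def prinMinorIdeal (K : Type*) [Field K] (n t : ℕ) :
    Ideal (MvPolynomial (Fin n × Fin n) K) :=
  Ideal.span {p | ∃ s : Finset (Fin n), s.card = t ∧
    p = ((genMat K n).submatrix (fun i : {x // x ∈ s} => (i : Fin n))
        (fun j : {x // x ∈ s} => (j : Fin n))).det}

section GeneratedByTwo

open Polynomial LaurentPolynomial

variable {B S : Type*} [CommRing B] [CommRing S]

instance LaurentPolynomial.instIsDomain [IsDomain B] : IsDomain B[T;T⁻¹] :=
  IsLocalization.isDomain_of_le_nonZeroDivisors (R := B[X]) (M := Submonoid.powers (X : B[X])) _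
    (powers_le_nonZeroDivisors_of_noZeroDivisors X_ne_zero)

instance LaurentPolynomial.instIsIntegrallyClosed [IsDomain B] [IsIntegrallyClosed B] :
    IsIntegrallyClosed B[T;T⁻¹] :=
  isIntegrallyClosed_of_isLocalization (R := B[X]) _ (Submonoid.powers (X : B[X]))
    (powers_le_nonZeroDivisors_of_noZeroDivisors X_ne_zero)

/-- If `u * v` lies in the image of `B` and `S` is generated by `u` and `v` over `B`, then every
element of `S` becomes a polynomial in `u` after multiplication by a power of `u`. -/
theorem exists_pow_mul_eq_eval₂ (ι : B →+* S) {u v : S} {c : B} (huv : u * v = ι c)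
    (hgen : ∀ R : Subring S, (∀ b, ι b ∈ R) → u ∈ R → v ∈ R → ∀ z, z ∈ R) (z : S) :
    ∃ (N : ℕ) (p : B[X]), u ^ N * z = p.eval₂ ι u := by
  let R : Subring S :=
    { carrier := {z | ∃ (N : ℕ) (p : B[X]), u ^ N * z = p.eval₂ ι u}
      mul_mem' := by
        rintro a b ⟨N, p, hp⟩ ⟨M, q, hq⟩
        refine ⟨N + M, p * q, ?_⟩
        rw [eval₂_mul, ← hp, ← hq]; ring
      one_mem' := ⟨0, 1, by simp⟩
      add_mem' := by
        rintro a b ⟨N, p, hp⟩ ⟨M, q, hq⟩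
        refine ⟨N + M, X ^ M * p + X ^ N * q, ?_⟩
        simp only [eval₂_add, eval₂_mul, eval₂_X_pow, ← hp, ← hq]; ring
      zero_mem' := ⟨0, 0, by simp⟩
      neg_mem' := by
        rintro a ⟨N, p, hp⟩
        exact ⟨N, -p, by rw [eval₂_neg, ← hp]; ring⟩ }
  exact hgen R (fun b => ⟨0, .C b, by simp⟩) ⟨0, X, by simp⟩ ⟨1, .C c, by simp [huv]⟩ z

theorem map_eval₂_eq_toLaurent (ι : B →+* S) {u : S} (ψ : S →+* B[T;T⁻¹])
    (hψι : ∀ b, ψ (ι b) = LaurentPolynomial.C b) (hψu : ψ u = T 1) (p : B[X]) :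
    ψ (p.eval₂ ι u) = toLaurent p := by
  rw [← Polynomial.coe_eval₂RingHom, ← RingHom.comp_apply]
  congr 1
  ext <;> simp [hψι, hψu]

theorem injective_of_exists_pow_mul_eq_eval₂ (ι : B →+* S) {u : S}
    (hu : ∀ z, u * z = 0 → z = 0)
    (hpoly : ∀ z, ∃ (N : ℕ) (p : B[X]), u ^ N * z = p.eval₂ ι u)
    (ψ : S →+* B[T;T⁻¹]) (hψι : ∀ b, ψ (ι b) = LaurentPolynomial.C b) (hψu : ψ u = T 1) :
    Function.Injective ψ := by
  rw [injective_iff_map_eq_zero]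
  intro z hz
  obtain ⟨N, p, hp⟩ := hpoly z
  have h0 : toLaurent p = 0 := by
    rw [← map_eval₂_eq_toLaurent ι ψ hψι hψu, ← hp, map_mul, hz, mul_zero]
  rw [toLaurent_eq_zero.mp h0, eval₂_zero] at hp
  induction N with
  | zero => simpa using hp
  | succ N ih => exact ih (hu _ (by rw [← hp]; ring))

/-- Integral elements of the fraction field of `S` have denominator a power of `u`, provided
inverting `u` turns `S` into a Laurent polynomial ring over a normal domain. -/
theorem exists_pow_mul_eq_algebraMap_of_isIntegral [IsDomain B] [IsIntegrallyClosed B] [IsDomain S]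
    (ι : B →+* S) {u : S}
    (hpoly : ∀ z, ∃ (N : ℕ) (p : B[X]), u ^ N * z = p.eval₂ ι u)
    (ψ : S →+* B[T;T⁻¹]) (hψι : ∀ b, ψ (ι b) = LaurentPolynomial.C b) (hψu : ψ u = T 1)
    {x : FractionRing S} (hx : IsIntegral S x) :
    ∃ (N : ℕ) (h : S), algebraMap S (FractionRing S) u ^ N * x = algebraMap S _ h := by
  have hu : u ≠ 0 := by
    rintro rfl
    exact (isUnit_T (R := B) 1).ne_zero (by rw [← hψu, map_zero])
  have hinj := injective_of_exists_pow_mul_eq_eval₂ ι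
    (fun z hz => (mul_eq_zero.mp hz).resolve_left hu) hpoly ψ hψι hψu
  let L := B[T;T⁻¹]
  let g : S →+* FractionRing L := (algebraMap L (FractionRing L)).comp ψ
  have hg : Function.Injective g := (IsFractionRing.injective L (FractionRing L)).comp hinj
  let Ψ : FractionRing S →+* FractionRing L := IsFractionRing.lift hg
  have hΨ : ∀ s, Ψ (algebraMap S _ s) = algebraMap L _ (ψ s) :=
    fun s => IsFractionRing.lift_algebraMap hg s
  have hint : IsIntegral L (Ψ x) := by
    obtain ⟨p, hp, hpx⟩ := hx
    refine ⟨p.map ψ, hp.map ψ, ?_⟩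
    rw [eval₂_map, ← (RingHom.ext hΨ : Ψ.comp (algebraMap S _) = (algebraMap L _).comp ψ),
      ← hom_eval₂, hpx, map_zero]
  obtain ⟨f, hf⟩ := IsIntegrallyClosed.isIntegral_iff.mp hint
  obtain ⟨N, p, hp⟩ := exists_T_pow f
  refine ⟨N, p.eval₂ ι u, Ψ.injective ?_⟩
  rw [map_mul, map_pow, hΨ, hΨ, map_eval₂_eq_toLaurent ι ψ hψι hψu, hp, hψu, ← hf, map_mul,
    ← map_pow, T_pow, mul_one, mul_comm]

end GeneratedByTwo

section HyperbolaRing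

open Polynomial

/-- The ring `B[v][u] / (u * v - c)`. -/
def HyperbolaRing (B : Type*) [CommRing B] (c : B) : Type _ :=
  B[X][X] ⧸ Ideal.span {(X * C X - C (C c) : B[X][X])}

noncomputable instance (B : Type*) [CommRing B] (c : B) : CommRing (HyperbolaRing B c) :=
  inferInstanceAs (CommRing (B[X][X] ⧸ Ideal.span {(X * C X - C (C c) : B[X][X])}))

namespace HyperbolaRing

variable {B : Type*} [CommRing B] (c : B)

/-- The quotient map. -/
noncomputable def mk : B[X][X] →+* HyperbolaRing B c := Ideal.Quotient.mk _

theorem mk_surjective : Function.Surjective (mk c) := Ideal.Quotient.mk_surjective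

theorem mk_eq_mk {x y : B[X][X]} : mk c x = mk c y ↔ X * C X - C (C c) ∣ x - y :=
  Ideal.Quotient.eq.trans Ideal.mem_span_singleton

theorem mk_eq_zero {x : B[X][X]} : mk c x = 0 ↔ X * C X - C (C c) ∣ x :=
  Ideal.Quotient.eq_zero_iff_mem.trans Ideal.mem_span_singleton

/-- The structure map of `HyperbolaRing B c`. -/
noncomputable def of : B →+* HyperbolaRing B c := (mk c).comp (C.comp C)

/-- The first coordinate. -/
noncomputable def u : HyperbolaRing B c := mk c X

/-- The second coordinate. -/
noncomputable def v : HyperbolaRing B c := mk c (C X)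

theorem u_mul_v : u c * v c = of c c := by
  rw [u, v, of, ← map_mul, RingHom.comp_apply, mk_eq_mk]
  exact dvd_rfl

variable {c} in
@[ext]
theorem hom_ext {S : Type*} [CommRing S] {f g : HyperbolaRing B c →+* S}
    (hof : f.comp (of c) = g.comp (of c)) (hu : f (u c) = g (u c)) (hv : f (v c) = g (v c)) :
    f = g := by
  refine Ideal.Quotient.ringHom_ext ?_
  ext b
  · exact RingHom.congr_fun hof b
  · exact hv
  · exact hu

variable {c} in
/-- The universal property of `HyperbolaRing B c`. -/
noncomputable def lift {S : Type*} [CommRing S] (f : B →+* S) (a b : S) (h : a * b = f c) :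
    HyperbolaRing B c →+* S :=
  Ideal.Quotient.lift _ (eval₂RingHom (eval₂RingHom f b) a) fun x hx => by
    obtain ⟨y, rfl⟩ := Ideal.mem_span_singleton.mp hx
    simp [h, mul_comm b a]

section Lift

variable {S : Type*} [CommRing S] (f : B →+* S) (a b : S) (h : a * b = f c)

@[simp]
theorem lift_of (r : B) : lift f a b h (of c r) = f r :=
  (Ideal.Quotient.lift_mk _ _ _).trans (by simp)

@[simp]
theorem lift_u : lift f a b h (u c) = a :=
  (Ideal.Quotient.lift_mk _ _ _).trans (by simp)

@[simp]
theorem lift_v : lift f a b h (v c) = b :=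
  (Ideal.Quotient.lift_mk _ _ _).trans (by simp)

end Lift

theorem mem_of_generators (R : Subring (HyperbolaRing B c)) (hof : ∀ b, of c b ∈ R)
    (hu : u c ∈ R) (hv : v c ∈ R) (z : HyperbolaRing B c) : z ∈ R := by
  let f : HyperbolaRing B c →+* R :=
    lift ((of c).codRestrict R hof) ⟨u c, hu⟩ ⟨v c, hv⟩ (Subtype.ext (u_mul_v c))
  have hf : R.subtype.comp f = RingHom.id _ := by
    ext <;> simp [f]
  rw [← RingHom.id_apply z, ← hf]
  exact (f z).2

/-- The embedding into Laurent polynomials with `u ↦ T` and `v ↦ c T⁻¹`. -/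
noncomputable def toLaurentU (c : B) : HyperbolaRing B c →+* LaurentPolynomial B :=
  lift LaurentPolynomial.C (.T 1) (.C c * .T (-1)) (by
    rw [mul_left_comm, ← LaurentPolynomial.T_add]; simp)

/-- The embedding into Laurent polynomials with `v ↦ T` and `u ↦ c T⁻¹`. -/
noncomputable def toLaurentV (c : B) : HyperbolaRing B c →+* LaurentPolynomial B :=
  lift LaurentPolynomial.C (.C c * .T (-1)) (.T 1) (by
    rw [mul_assoc, ← LaurentPolynomial.T_add]; simp)

theorem of_injective (c : B) : Function.Injective (of c) := by
  have h : ∀ b, toLaurentU c (of c b) = LaurentPolynomial.C b := by simp [toLaurentU]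
  intro a b hab
  have := congrArg (toLaurentU c) hab
  rw [h, h, ← toLaurent_C, ← toLaurent_C] at this
  exact C_injective (toLaurent_injective this)

variable {c} [IsDomain B]

theorem eq_zero_of_u_mul_eq_zero (hc : c ≠ 0) (z : HyperbolaRing B c) (hz : u c * z = 0) :
    z = 0 := by
  obtain ⟨w, rfl⟩ := mk_surjective c z
  rw [u, ← map_mul, mk_eq_zero] at hz
  obtain ⟨q, hq⟩ := hz
  have h0 : q.coeff 0 = 0 := by
    have := congrArg (fun p => coeff p 0) hq
    simpa [sub_mul, mul_assoc, hc] using this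
  obtain ⟨q', rfl⟩ := X_dvd_iff.mpr h0
  rw [mk_eq_zero]
  exact ⟨q', mul_left_cancel₀ X_ne_zero (by rw [hq]; ring)⟩

theorem u_dvd_of_u_dvd_v_mul (hc : c ≠ 0) (z : HyperbolaRing B c) (hz : u c ∣ v c * z) :
    u c ∣ z := by
  obtain ⟨y, hy⟩ := hz
  obtain ⟨z, rfl⟩ := mk_surjective c z
  obtain ⟨y, rfl⟩ := mk_surjective c y
  rw [u, v, ← map_mul, ← map_mul, mk_eq_mk] at hy
  obtain ⟨q, hq⟩ := hy
  have h0 : X * z.coeff 0 = - (C c * q.coeff 0) := by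
    have := congrArg (fun p => coeff p 0) hq
    simpa [sub_mul, mul_assoc] using this
  have h1 : (q.coeff 0).coeff 0 = 0 := by
    have := congrArg (fun p => coeff p 0) h0
    simpa [hc] using this
  obtain ⟨r, hr⟩ := X_dvd_iff.mpr h1
  have h2 : z.coeff 0 = - (C c * r) := mul_left_cancel₀ X_ne_zero (by rw [h0, hr]; ring)
  obtain ⟨z', hz'⟩ : X ∣ z - C (z.coeff 0) := X_dvd_iff.mpr (by simp)
  rw [sub_eq_iff_eq_add.mp hz', h2, map_add, map_mul, map_neg, map_neg, C_mul, map_mul]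
  refine dvd_add (dvd_mul_right _ _) ((Dvd.dvd.mul_right ?_ _).neg_right)
  exact ⟨v c, (u_mul_v c).symm⟩

theorem isDomain (hc : c ≠ 0) : IsDomain (HyperbolaRing B c) :=
  (injective_of_exists_pow_mul_eq_eval₂ (of c) (eq_zero_of_u_mul_eq_zero hc)
    (exists_pow_mul_eq_eval₂ (of c) (u_mul_v c) (mem_of_generators c)) (toLaurentU c)
    (by simp [toLaurentU]) (by simp [toLaurentU])).isDomain _

theorem u_ne_zero (hc : c ≠ 0) : u c ≠ 0 := fun h =>
  have := isDomain hc
  one_ne_zero (eq_zero_of_u_mul_eq_zero hc 1 (by rw [h, zero_mul]))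

theorem u_pow_dvd_of_v_pow_mul (hc : c ≠ 0) (M : ℕ) (N : ℕ) (z : HyperbolaRing B c)
    (hz : u c ^ N ∣ v c ^ M * z) : u c ^ N ∣ z := by
  have := isDomain hc
  have hu := u_ne_zero hc
  have key : ∀ (M : ℕ) (z : HyperbolaRing B c), u c ∣ v c ^ M * z → u c ∣ z := by
    intro M
    induction M with
    | zero => intro z hz; simpa using hz
    | succ M ih =>
      intro z hz
      exact ih z (u_dvd_of_u_dvd_v_mul hc _ (by rwa [pow_succ', mul_assoc] at hz))
  induction N generalizing z with
  | zero => simp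
  | succ N ih =>
    obtain ⟨y, rfl⟩ := key M z ((dvd_pow_self _ N.succ_ne_zero).trans hz)
    rw [pow_succ', mul_left_comm, mul_dvd_mul_iff_left hu] at hz
    rw [pow_succ']
    exact mul_dvd_mul_left _ (ih y hz)

theorem isIntegrallyClosed (hc : c ≠ 0) [IsIntegrallyClosed B] :
    IsIntegrallyClosed (HyperbolaRing B c) := by
  have := isDomain hc
  have hu := u_ne_zero hc
  rw [isIntegrallyClosed_iff (FractionRing (HyperbolaRing B c))]
  intro x hx
  obtain ⟨N, h, hN⟩ := exists_pow_mul_eq_algebraMap_of_isIntegral (of c)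
    (exists_pow_mul_eq_eval₂ (of c) (u_mul_v c) (mem_of_generators c)) (toLaurentU c)
    (by simp [toLaurentU]) (by simp [toLaurentU]) hx
  obtain ⟨M, k, hM⟩ := exists_pow_mul_eq_algebraMap_of_isIntegral (of c)
    (exists_pow_mul_eq_eval₂ (of c) ((mul_comm _ _).trans (u_mul_v c))
      fun R hof hv hu => mem_of_generators c R hof hu hv) (toLaurentV c)
    (by simp [toLaurentV]) (by simp [toLaurentV]) hx
  have hinj := IsFractionRing.injective (HyperbolaRing B c) (FractionRing (HyperbolaRing B c))
  obtain ⟨y, rfl⟩ := u_pow_dvd_of_v_pow_mul hc M N h ⟨k, hinj (by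
    rw [map_mul, map_mul, ← hN, ← hM, map_pow, map_pow]; ring)⟩
  refine ⟨y, ?_⟩
  rw [map_mul, map_pow] at hN
  refine (mul_left_cancel₀ (pow_ne_zero _ ?_) hN).symm
  rwa [Ne, map_eq_zero_iff _ hinj]

end HyperbolaRing

end HyperbolaRing

section HyperbolaProduct

open MvPolynomial

/-- The ring obtained from `B` by adjoining, for each `i : ι`, two elements with product `c i`. -/
def HyperbolaProduct (B : Type*) [CommRing B] {ι : Type*} (c : ι → B) : Type _ :=
  MvPolynomial (ι ⊕ ι) B ⧸ Ideal.span
    (Set.range fun i => (X (Sum.inl i) * X (Sum.inr i) - C (c i) : MvPolynomial (ι ⊕ ι) B))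

noncomputable instance (B : Type*) [CommRing B] {ι : Type*} (c : ι → B) :
    CommRing (HyperbolaProduct B c) :=
  inferInstanceAs (CommRing (MvPolynomial (ι ⊕ ι) B ⧸ Ideal.span
    (Set.range fun i => (X (Sum.inl i) * X (Sum.inr i) - C (c i) : MvPolynomial (ι ⊕ ι) B))))

namespace HyperbolaProduct

variable {B : Type*} [CommRing B] {ι : Type*} (c : ι → B)

/-- The quotient map. -/
noncomputable def mk : MvPolynomial (ι ⊕ ι) B →+* HyperbolaProduct B c := Ideal.Quotient.mk _

/-- The structure map of `HyperbolaProduct B c`. -/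
noncomputable def of : B →+* HyperbolaProduct B c := (mk c).comp C

/-- The first coordinates. -/
noncomputable def u (i : ι) : HyperbolaProduct B c := mk c (X (Sum.inl i))

/-- The second coordinates. -/
noncomputable def v (i : ι) : HyperbolaProduct B c := mk c (X (Sum.inr i))

theorem u_mul_v (i : ι) : u c i * v c i = of c (c i) := by
  rw [u, v, of, ← map_mul, RingHom.comp_apply]
  exact Ideal.Quotient.eq.mpr (Ideal.subset_span ⟨i, rfl⟩)

variable {c} in
@[ext]
theorem hom_ext {S : Type*} [CommRing S] {f g : HyperbolaProduct B c →+* S}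
    (hof : f.comp (of c) = g.comp (of c)) (hu : ∀ i, f (u c i) = g (u c i))
    (hv : ∀ i, f (v c i) = g (v c i)) : f = g := by
  refine Ideal.Quotient.ringHom_ext (MvPolynomial.ringHom_ext (RingHom.congr_fun hof) ?_)
  rintro (i | i)
  exacts [hu i, hv i]

variable {c} in
/-- The universal property of `HyperbolaProduct B c`. -/
noncomputable def lift {S : Type*} [CommRing S] (f : B →+* S) (a b : ι → S)
    (h : ∀ i, a i * b i = f (c i)) : HyperbolaProduct B c →+* S :=
  Ideal.Quotient.lift _ (eval₂Hom f (Sum.elim a b)) fun x hx => by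
    rw [← RingHom.mem_ker]
    refine Ideal.span_le.mpr ?_ hx
    rintro _ ⟨i, rfl⟩
    simp [h]

section Lift

variable {S : Type*} [CommRing S] (f : B →+* S) (a b : ι → S) (h : ∀ i, a i * b i = f (c i))

@[simp]
theorem lift_of (r : B) : lift f a b h (of c r) = f r :=
  (Ideal.Quotient.lift_mk _ _ _).trans (by simp)

@[simp]
theorem lift_u (i : ι) : lift f a b h (u c i) = a i :=
  (Ideal.Quotient.lift_mk _ _ _).trans (by simp)

@[simp]
theorem lift_v (i : ι) : lift f a b h (v c i) = b i :=
  (Ideal.Quotient.lift_mk _ _ _).trans (by simp)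

end Lift

/-- Without generators nothing is adjoined. -/
noncomputable def equivOfIsEmpty [IsEmpty ι] : B ≃+* HyperbolaProduct B c :=
  RingEquiv.ofRingHom (of c) (lift (RingHom.id B) isEmptyElim isEmptyElim isEmptyElim)
    (by ext i <;> first | exact isEmptyElim i | simp) (by ext; simp)

/-- Reindexing. -/
noncomputable def reindex {κ : Type*} (e : κ ≃ ι) :
    HyperbolaProduct B (c ∘ e) ≃+* HyperbolaProduct B c :=
  RingEquiv.ofRingHom
    (lift (of c) (u c ∘ e) (v c ∘ e) fun i => u_mul_v c (e i))
    (lift (of (c ∘ e)) (u (c ∘ e) ∘ e.symm) (v (c ∘ e) ∘ e.symm) fun i => by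
      simpa using u_mul_v (c ∘ e) (e.symm i))
    (by ext <;> simp) (by ext <;> simp)

/-- Adjoining a family indexed by `Option ι` can be done one pair first, then the others. -/
noncomputable def optionEquiv (c : Option ι → B) :
    HyperbolaProduct (HyperbolaRing B (c none))
      (fun i : ι => HyperbolaRing.of (c none) (c (some i))) ≃+* HyperbolaProduct B c :=
  RingEquiv.ofRingHom
    (lift (HyperbolaRing.lift (of c) (u c none) (v c none) (u_mul_v c none))
      (fun i => u c (some i)) (fun i => v c (some i))
      fun i => by simpa using u_mul_v c (some i))
    (lift ((of _).comp (HyperbolaRing.of (c none)))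
      (fun i => i.elim (of _ (HyperbolaRing.u (c none))) (u _))
      (fun i => i.elim (of _ (HyperbolaRing.v (c none))) (v _))
      fun i => by
        cases i with
        | none =>
          simp only [Option.elim_none, RingHom.comp_apply, ← map_mul, HyperbolaRing.u_mul_v]
        | some i => exact u_mul_v _ i)
    (by
      ext i
      · simp
      · cases i <;> simp
      · cases i <;> simp)
    (by ext <;> simp)

/-- Adjoining to a normal domain finitely many pairs with prescribed nonzero products gives a
normal domain. -/
theorem isDomain_and_isIntegrallyClosed.{u} (ι : Type*) [Finite ι] :
    ∀ (B : Type u) [CommRing B] [IsDomain B] [IsIntegrallyClosed B] (c : ι → B),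
      (∀ i, c i ≠ 0) →
        IsDomain (HyperbolaProduct B c) ∧ IsIntegrallyClosed (HyperbolaProduct B c) := by
  induction ι using Finite.induction_empty_option with
  | of_equiv e ih =>
    intro B _ _ _ c hc
    obtain ⟨h₁, h₂⟩ := ih B (c ∘ e) fun i => hc (e i)
    exact ⟨(reindex c e).symm.toMulEquiv.isDomain _, .of_equiv (reindex c e)⟩
  | h_empty =>
    intro B _ _ _ c _
    exact ⟨(equivOfIsEmpty c).symm.toMulEquiv.isDomain _, .of_equiv (equivOfIsEmpty c)⟩
  | h_option ih =>
    intro B _ _ _ c hc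
    have := HyperbolaRing.isDomain (hc none)
    have := HyperbolaRing.isIntegrallyClosed (hc none)
    obtain ⟨h₁, h₂⟩ := ih (HyperbolaRing B (c none))
      (fun i => HyperbolaRing.of (c none) (c (some i)))
      fun i => (map_ne_zero_iff _ (HyperbolaRing.of_injective _)).mpr (hc (some i))
    exact ⟨(optionEquiv c).symm.toMulEquiv.isDomain _, .of_equiv (optionEquiv c)⟩

end HyperbolaProduct

end HyperbolaProduct

section PrincipalMinors

variable (K : Type*) [Field K] (n : ℕ)

theorem det_submatrix_pair {R : Type*} [CommRing R] {m : Type*} [DecidableEq m]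
    (A : Matrix m m R) {i j : m} (hij : i ≠ j) :
    (A.submatrix (fun k : {x // x ∈ ({i, j} : Finset m)} => (k : m))
      (fun k : {x // x ∈ ({i, j} : Finset m)} => (k : m))).det =
      A i i * A j j - A i j * A j i := by
  let f : Fin 2 → {x // x ∈ ({i, j} : Finset m)} := ![⟨i, by simp⟩, ⟨j, by simp⟩]
  have hf : Function.Bijective f := by
    constructor
    · intro a b
      fin_cases a <;> fin_cases b <;> simp [f, hij, hij.symm]
    · rintro ⟨x, hx⟩
      obtain rfl | rfl := by simpa using hx
      exacts [⟨0, rfl⟩, ⟨1, rfl⟩]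
  rw [← Matrix.det_submatrix_equiv_self (Equiv.ofBijective f hf), Matrix.det_fin_two]
  simp [f]

theorem prinMinorIdeal_two :
    prinMinorIdeal K n 2 = Ideal.span (Set.range fun q : {q : Fin n × Fin n // q.1 < q.2} =>
      (MvPolynomial.X (q.1.1, q.1.1) * MvPolynomial.X (q.1.2, q.1.2) -
        MvPolynomial.X q.1 * MvPolynomial.X (q.1.2, q.1.1) : MvPolynomial (Fin n × Fin n) K)) := by
  apply le_antisymm
  · refine Ideal.span_le.mpr ?_
    rintro _ ⟨s, hs, rfl⟩
    obtain ⟨i, j, hij, rfl⟩ := Finset.card_eq_two.mp hs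
    rw [det_submatrix_pair _ hij]
    obtain h | h := hij.lt_or_gt
    · exact Ideal.subset_span ⟨⟨(i, j), h⟩, rfl⟩
    · refine Ideal.subset_span ⟨⟨(j, i), h⟩, ?_⟩
      simp only [genMat]
      ring
  · refine Ideal.span_mono ?_
    rintro _ ⟨⟨⟨i, j⟩, h⟩, rfl⟩
    have hij : i ≠ j := ne_of_lt h
    refine ⟨{i, j}, Finset.card_pair hij, ?_⟩
    rw [det_submatrix_pair (genMat K n) hij]
    rfl

/-- The products of pairs of diagonal entries. -/
noncomputable def diagProd (q : {q : Fin n × Fin n // q.1 < q.2}) : MvPolynomial (Fin n) K :=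
  MvPolynomial.X q.1.1 * MvPolynomial.X q.1.2

/-- The image of the generic matrix in the ring obtained from `K[x₁₁, …, xₙₙ]` by adjoining the
pairs of mirror off-diagonal entries. -/
noncomputable def genEntry (q : Fin n × Fin n) :
    HyperbolaProduct (MvPolynomial (Fin n) K) (diagProd K n) :=
  if h : q.1 < q.2 then HyperbolaProduct.u (diagProd K n) ⟨q, h⟩
  else if h : q.2 < q.1 then HyperbolaProduct.v (diagProd K n) ⟨q.swap, h⟩
  else HyperbolaProduct.of (diagProd K n) (MvPolynomial.X q.1)

theorem genEntry_diag (i : Fin n) :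
    genEntry K n (i, i) = HyperbolaProduct.of (diagProd K n) (MvPolynomial.X i) :=
  (dif_neg (lt_irrefl i)).trans (dif_neg (lt_irrefl i))

theorem genEntry_of_lt (q : {q : Fin n × Fin n // q.1 < q.2}) :
    genEntry K n q.1 = HyperbolaProduct.u (diagProd K n) q :=
  dif_pos q.2

theorem genEntry_swap_of_lt (q : {q : Fin n × Fin n // q.1 < q.2}) :
    genEntry K n (q.1.2, q.1.1) = HyperbolaProduct.v (diagProd K n) q :=
  (dif_neg q.2.not_gt).trans (dif_pos q.2)

/-- The quotient by the principal `2`-minors adjoins to `K[x₁₁, …, xₙₙ]` the pairs of mirror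
off-diagonal entries. -/
noncomputable def quotientPrinMinorIdealTwoEquiv :
    HyperbolaProduct (MvPolynomial (Fin n) K) (diagProd K n) ≃+*
      MvPolynomial (Fin n × Fin n) K ⧸ prinMinorIdeal K n 2 :=
  RingEquiv.ofRingHom
    (HyperbolaProduct.lift
      ((Ideal.Quotient.mk _).comp (MvPolynomial.rename fun i : Fin n => (i, i)).toRingHom)
      (fun q => Ideal.Quotient.mk _ (MvPolynomial.X q.1))
      (fun q => Ideal.Quotient.mk _ (MvPolynomial.X (q.1.2, q.1.1)))
      fun q => by
        rw [← map_mul, RingHom.comp_apply, eq_comm, Ideal.Quotient.eq, prinMinorIdeal_two]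
        exact Ideal.subset_span ⟨q, by simp [diagProd]⟩)
    (Ideal.Quotient.lift _
      (MvPolynomial.eval₂Hom ((HyperbolaProduct.of (diagProd K n)).comp MvPolynomial.C)
        (genEntry K n))
      fun x hx => by
        rw [prinMinorIdeal_two] at hx
        rw [← RingHom.mem_ker]
        refine Ideal.span_le.mpr ?_ hx
        rintro _ ⟨q, rfl⟩
        simp [genEntry_diag, genEntry_of_lt, genEntry_swap_of_lt, HyperbolaProduct.u_mul_v,
          diagProd])
    (by
      refine Ideal.Quotient.ringHom_ext (MvPolynomial.ringHom_ext (fun r => by simp) ?_)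
      rintro ⟨i, j⟩
      obtain h | rfl | h := lt_trichotomy i j
      · simp [genEntry_of_lt K n ⟨(i, j), h⟩]
      · simp [genEntry_diag]
      · simp [genEntry_swap_of_lt K n ⟨(j, i), h⟩])
    (by
      ext q
      · simp
      · simp [genEntry_diag]
      · simp [genEntry_of_lt]
      · simp [genEntry_swap_of_lt])

end PrincipalMinors

/-- For every positive integer `n`, the quotient `K[X]/P₂` by the ideal of principal
2-minors is a normal domain: an integral domain which is integrally closed in its
field of fractions. -/
theorem prinMinorIdeal_two_quotient_normal (K : Type*) [Field K] [IsAlgClosed K]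
    (n : ℕ) (hn : 0 < n) :
    IsDomain (MvPolynomial (Fin n × Fin n) K ⧸ prinMinorIdeal K n 2) ∧
      IsIntegrallyClosed (MvPolynomial (Fin n × Fin n) K ⧸ prinMinorIdeal K n 2) := by
  obtain ⟨h₁, h₂⟩ := HyperbolaProduct.isDomain_and_isIntegrallyClosed _ _ (diagProd K n)
    fun q => mul_ne_zero (MvPolynomial.X_ne_zero _) (MvPolynomial.X_ne_zero _)
  exact ⟨(quotientPrinMinorIdealTwoEquiv K n).symm.toMulEquiv.isDomain _,
    .of_equiv (quotientPrinMinorIdealTwoEquiv K n)⟩
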